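/- arXiv:2601.11828 — 3 statements merged into one kernel-verified Lean document; each statement's English description precedes it below -/
import Mathlib

section
/- Let φ : [0,∞) → [0,∞) be bounded and continuous, define Φ(z) := ∫₀^z φ(|ζ|) dζ, let ρ₀ be a continuous nonnegative function on ℝ with ∫_ℝ ρ₀ = 1, and let ψ₀ : ℝ → ℝ. Suppose X : ℝ × [0,T] → ℝ is continuously differentiable with X(α,0) = α for all α, solves ∂_t X(α,t) = ψ₀(α) − ∫_ℝ Φ(X(α,t) − X(γ,t)) ρ₀(γ) dγ for all (α,t) ∈ ℝ × [0,T], and is order-preserving in the sense that X(β,t) ≥ X(α,t) whenever α ≤ β and t ∈ [0,T]. If there exist α < β with ψ₀(β) < ψ₀(α), then T ≤ (β − α)/(ψ₀(α) − ψ₀(β)). -/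
open MeasureTheory Set

/-- Remark 2.2, finite-time loss of regularity for radial protocols.
Let `φ : [0,∞) → [0,∞)` be bounded and continuous, `Φ(z) := ∫₀^z φ(|ζ|) dζ`, `ρ₀` a
continuous probability density, and let `X` be a C¹ order-preserving flow on
`ℝ × [0,T]` with `X(α,0) = α` solving
`∂_t X(α,t) = ψ₀(α) − ∫ Φ(X(α,t) − X(γ,t)) ρ₀(γ) dγ`.
If `ψ₀(β) < ψ₀(α)` for some `α < β`, then `T ≤ (β−α)/(ψ₀(α)−ψ₀(β))`. -/
theorem finite_time_breakdown_radial
    (φ : ℝ → ℝ) (hφc : Continuous φ)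
    (hφnn : ∀ r, 0 ≤ r → 0 ≤ φ r) (hφbdd : ∃ C, ∀ r, 0 ≤ r → φ r ≤ C)
    (ρ₀ : ℝ → ℝ) (hρ₀c : Continuous ρ₀) (hρ₀nn : ∀ x, 0 ≤ ρ₀ x)
    (hρ₀int : Integrable ρ₀) (hρ₀mass : ∫ x, ρ₀ x = 1)
    (ψ₀ : ℝ → ℝ) (T : ℝ) (hT : 0 ≤ T)
    (X : ℝ → ℝ → ℝ)
    (hXC1 : ContDiffOn ℝ 1 (Function.uncurry X) (univ ×ˢ Icc (0:ℝ) T))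
    (hX0 : ∀ α, X α 0 = α)
    (hXode : ∀ α, ∀ t ∈ Icc (0:ℝ) T, HasDerivWithinAt (fun τ => X α τ)
      (ψ₀ α - ∫ γ, (∫ ζ in (0:ℝ)..(X α t - X γ t), φ |ζ|) * ρ₀ γ) (Icc 0 T) t)
    (hXord : ∀ α β, α ≤ β → ∀ t ∈ Icc (0:ℝ) T, X α t ≤ X β t)
    (α β : ℝ) (hαβ : α < β) (hψ : ψ₀ β < ψ₀ α) :
    T ≤ (β - α) / (ψ₀ α - ψ₀ β) := by
  obtain ⟨C, hC⟩ := hφbdd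
  have hφa : Continuous (fun ζ : ℝ => φ |ζ|) := hφc.comp continuous_abs
  have hii : ∀ a b : ℝ, IntervalIntegrable (fun ζ : ℝ => φ |ζ|) volume a b :=
    fun a b => hφa.intervalIntegrable a b
  have hΦc : Continuous (fun z : ℝ => ∫ ζ in (0:ℝ)..z, φ |ζ|) :=
    intervalIntegral.continuous_primitive hii 0
  -- monotonicity of the alignment term
  have key : ∀ t ∈ Icc (0:ℝ) T,
      (∫ γ, (∫ ζ in (0:ℝ)..(X α t - X γ t), φ |ζ|) * ρ₀ γ) ≤
      ∫ γ, (∫ ζ in (0:ℝ)..(X β t - X γ t), φ |ζ|) * ρ₀ γ := by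
    intro t ht
    have hmono : Monotone (fun γ => X γ t) := fun a b hab => hXord a b hab t ht
    have hmeas : ∀ a : ℝ, Measurable
        (fun γ => (∫ ζ in (0:ℝ)..(X a t - X γ t), φ |ζ|) * ρ₀ γ) := by
      intro a
      exact (hΦc.measurable.comp (measurable_const.sub hmono.measurable)).mul hρ₀c.measurable
    have hle := hXord α β hαβ.le t ht
    have hdiff : ∀ γ, (∫ ζ in (0:ℝ)..(X β t - X γ t), φ |ζ|) * ρ₀ γ
        - (∫ ζ in (0:ℝ)..(X α t - X γ t), φ |ζ|) * ρ₀ γ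
        = (∫ ζ in (X α t - X γ t)..(X β t - X γ t), φ |ζ|) * ρ₀ γ := by
      intro γ
      rw [← sub_mul, intervalIntegral.integral_interval_sub_left (hii _ _) (hii _ _)]
    have hnn : ∀ γ, 0 ≤ (∫ ζ in (X α t - X γ t)..(X β t - X γ t), φ |ζ|) := fun γ =>
      intervalIntegral.integral_nonneg (by linarith) (fun u _ => hφnn _ (abs_nonneg u))
    have hub : ∀ γ, (∫ ζ in (X α t - X γ t)..(X β t - X γ t), φ |ζ|)
        ≤ C * (X β t - X α t) := by
      intro γ
      have h := intervalIntegral.integral_mono_on (μ := volume)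
        (by linarith : X α t - X γ t ≤ X β t - X γ t) (hii _ _)
        (intervalIntegrable_const (c := C)) (fun u _ => hC _ (abs_nonneg u))
      rw [intervalIntegral.integral_const, smul_eq_mul] at h
      linarith
    have hdint : Integrable (fun γ => (∫ ζ in (0:ℝ)..(X β t - X γ t), φ |ζ|) * ρ₀ γ
        - (∫ ζ in (0:ℝ)..(X α t - X γ t), φ |ζ|) * ρ₀ γ) := by
      refine (hρ₀int.const_mul (C * (X β t - X α t))).mono'
        ((hmeas β).sub (hmeas α)).aestronglyMeasurable (Filter.Eventually.of_forall ?_)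
      intro γ
      rw [hdiff γ, Real.norm_of_nonneg (mul_nonneg (hnn γ) (hρ₀nn γ))]
      exact mul_le_mul_of_nonneg_right (hub γ) (hρ₀nn γ)
    by_cases hi : Integrable (fun γ => (∫ ζ in (0:ℝ)..(X α t - X γ t), φ |ζ|) * ρ₀ γ)
    · have hj : Integrable (fun γ => (∫ ζ in (0:ℝ)..(X β t - X γ t), φ |ζ|) * ρ₀ γ) := by
        refine (hdint.add hi).congr (Filter.Eventually.of_forall fun γ => ?_)
        simp
      refine integral_mono hi hj fun γ => ?_
      have h1 := hdiff γ
      have h2 := mul_nonneg (hnn γ) (hρ₀nn γ)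
      simp only
      linarith
    · have hj : ¬ Integrable (fun γ => (∫ ζ in (0:ℝ)..(X β t - X γ t), φ |ζ|) * ρ₀ γ) := by
        intro hj
        apply hi
        refine (hj.sub hdint).congr (Filter.Eventually.of_forall fun γ => ?_)
        simp
      rw [integral_undef hi, integral_undef hj]
  have hder : ∀ t ∈ Icc (0:ℝ) T, HasDerivWithinAt
      (fun τ => X β τ - X α τ + (ψ₀ α - ψ₀ β) * τ) _ (Icc 0 T) t := fun t ht =>
    ((hXode β t ht).sub (hXode α t ht)).add
      ((hasDerivWithinAt_id t (Icc 0 T)).const_mul (ψ₀ α - ψ₀ β))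
  have hanti : AntitoneOn (fun τ => X β τ - X α τ + (ψ₀ α - ψ₀ β) * τ) (Icc 0 T) := by
    refine antitoneOn_of_hasDerivWithinAt_nonpos (convex_Icc 0 T)
      (fun t ht => (hder t ht).continuousWithinAt)
      (fun t ht => (hder t (interior_subset ht)).mono interior_subset) ?_
    intro t ht
    have := key t (interior_subset ht)
    linarith
  have h := hanti (left_mem_Icc.2 hT) (right_mem_Icc.2 hT) hT
  simp only [hX0] at h
  have h2 := hXord α β hαβ.le T (right_mem_Icc.2 hT)
  rw [le_div_iff₀ (by linarith)]
  linarith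
end

section
/- Let φ : [0,1] → [0,∞) be continuous and bounded, let T > 0, and let ρ, u : ℝ × [0,T) → ℝ be continuously differentiable with ρ(x,t) > 0 for all (x,t), ∫_ℝ ρ(x,t) dx = 1 for all t, and u bounded. Assume (ρ,u) solves pointwise the purely topological Euler Alignment system: ∂_t ρ + ∂_x(ρu) = 0 and ∂_t u + u ∂_x u = −∫_ℝ φ(|M(x,t) − M(y,t)|)(u(x,t) − u(y,t)) ρ(y,t) dy, where M(x,t) := ∫_{−∞}^x ρ(z,t) dz. For m ∈ (0,1) and t ∈ [0,T), define v(m,t) := u(X(m,t), t), where X(m,t) is the unique x with M(x,t) = m. Then v satisfies the decoupled autonomous equation ∂_t v(m,t) = −∫₀¹ φ(|m − m'|)(v(m,t) − v(m',t)) dm' for all (m,t) ∈ (0,1) × (0,T). -/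
open MeasureTheory Set Filter Topology

lemma partials_aux {T : ℝ} (f : ℝ → ℝ → ℝ)
    (hf : ContDiffOn ℝ 1 (Function.uncurry f) (univ ×ˢ Ico (0:ℝ) T)) (x t : ℝ)
    (ht : t ∈ Ico (0:ℝ) T) :
    ∃ L : ℝ × ℝ →L[ℝ] ℝ, HasFDerivWithinAt (Function.uncurry f) L (univ ×ˢ Ico (0:ℝ) T) (x, t) ∧
      L (1, 0) = deriv (fun y => f y t) x ∧
      L (0, 1) = derivWithin (fun τ => f x τ) (Ico 0 T) t := by
  have hd := (hf.differentiableOn one_ne_zero (x, t) ⟨mem_univ _, ht⟩).hasFDerivWithinAt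
  refine ⟨_, hd, ?_, ?_⟩
  · have h1 : HasDerivWithinAt (fun y : ℝ => (y, t)) ((1:ℝ), (0:ℝ)) univ x :=
      (hasDerivWithinAt_id x univ).prodMk (hasDerivWithinAt_const x univ t)
    have h2 := hd.comp_hasDerivWithinAt (t := univ ×ˢ Ico (0:ℝ) T) x h1
      (fun y _ => ⟨mem_univ _, ht⟩)
    exact (hasDerivWithinAt_univ.1 h2).deriv.symm
  · have h1 : HasDerivWithinAt (fun τ : ℝ => (x, τ)) ((0:ℝ), (1:ℝ)) (Ico 0 T) t :=
      (hasDerivWithinAt_const t _ x).prodMk (hasDerivWithinAt_id t _)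
    have h2 := hd.comp_hasDerivWithinAt (t := univ ×ˢ Ico (0:ℝ) T) t h1
      (fun y hy => ⟨mem_univ _, hy⟩)
    exact (h2.derivWithin (uniqueDiffOn_Ico 0 T t ht)).symm

lemma slice_x {T : ℝ} (f : ℝ → ℝ → ℝ)
    (hf : ContinuousOn (Function.uncurry f) (univ ×ˢ Ico (0:ℝ) T)) (t : ℝ)
    (ht : t ∈ Ico (0:ℝ) T) : Continuous (fun y => f y t) := by
  rw [← continuousOn_univ]
  exact hf.comp (f := fun y : ℝ => (y, t)) (by fun_prop) (fun y _ => ⟨mem_univ _, ht⟩)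

lemma slice_t {T : ℝ} (f : ℝ → ℝ → ℝ)
    (hf : ContinuousOn (Function.uncurry f) (univ ×ˢ Ico (0:ℝ) T)) (x : ℝ) :
    ContinuousOn (fun τ => f x τ) (Ico 0 T) :=
  hf.comp (f := fun τ : ℝ => (x, τ)) (by fun_prop) (fun y hy => ⟨mem_univ _, hy⟩)

lemma box_balance {T : ℝ} (ρ q : ℝ → ℝ → ℝ)
    (hρ : ContDiffOn ℝ 1 (Function.uncurry ρ) (univ ×ˢ Ico (0:ℝ) T))
    (hq : ContDiffOn ℝ 1 (Function.uncurry q) (univ ×ˢ Ico (0:ℝ) T))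
    (hcont : ∀ x, ∀ t ∈ Ico (0:ℝ) T,
      derivWithin (fun τ => ρ x τ) (Ico 0 T) t + deriv (fun y => q y t) x = 0)
    (a b s t : ℝ) (hab : a ≤ b) (hst : s ≤ t) (hs : s ∈ Ico (0:ℝ) T) (ht : t ∈ Ico (0:ℝ) T) :
    (∫ x in a..b, ρ x t) - (∫ x in a..b, ρ x s) + (∫ τ in s..t, q b τ)
      - (∫ τ in s..t, q a τ) = 0 := by
  have hsub : Icc ((a, s) : ℝ × ℝ) (b, t) ⊆ univ ×ˢ Ico (0:ℝ) T := by
    rintro ⟨x, τ⟩ ⟨h1, h2⟩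
    exact ⟨mem_univ _, hs.1.trans h1.2, lt_of_le_of_lt h2.2 ht.2⟩
  have hnhds : ∀ p ∈ Ioo a b ×ˢ Ioo s t, (univ ×ˢ Ico (0:ℝ) T) ∈ 𝓝 p := by
    rintro ⟨x, τ⟩ ⟨_, h2⟩
    refine prod_mem_nhds univ_mem (Ico_mem_nhds (lt_of_le_of_lt hs.1 h2.1) (h2.2.trans ht.2))
  have hzero : ∀ p ∈ Ioo a b ×ˢ Ioo s t,
      fderiv ℝ (Function.uncurry q) p (1, 0) + fderiv ℝ (Function.uncurry ρ) p (0, 1) = 0 := by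
    rintro ⟨x, τ⟩ hp
    have hτ : τ ∈ Ico (0:ℝ) T := (mem_of_mem_nhds (hnhds _ hp)).2
    obtain ⟨L, hL, hL1, -⟩ := partials_aux q hq x τ hτ
    obtain ⟨K, hK, -, hK2⟩ := partials_aux ρ hρ x τ hτ
    rw [(hL.hasFDerivAt (hnhds _ hp)).fderiv, (hK.hasFDerivAt (hnhds _ hp)).fderiv, hL1, hK2,
      add_comm]
    exact hcont x τ hτ
  have hae : (fun p => fderiv ℝ (Function.uncurry q) p (1, 0) +
      fderiv ℝ (Function.uncurry ρ) p (0, 1)) =ᵐ[volume.restrict (Icc ((a, s) : ℝ × ℝ) (b, t))]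
      fun _ => 0 := by
    have h1 : (Ioo a b ×ˢ Ioo s t : Set (ℝ × ℝ)) =ᵐ[volume] Icc ((a, s) : ℝ × ℝ) (b, t) := by
      rw [← Icc_prod_Icc]
      exact Measure.set_prod_ae_eq Ioo_ae_eq_Icc Ioo_ae_eq_Icc
    rw [← Measure.restrict_congr_set h1]
    filter_upwards [ae_restrict_mem (measurableSet_Ioo.prod measurableSet_Ioo)] with p hp
    exact hzero p hp
  have key := integral_divergence_prod_Icc_of_hasFDerivAt_of_le (Function.uncurry q)
    (Function.uncurry ρ) (fderiv ℝ (Function.uncurry q)) (fderiv ℝ (Function.uncurry ρ))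
    (a, s) (b, t) ⟨hab, hst⟩ (hq.continuousOn.mono hsub) (hρ.continuousOn.mono hsub)
    (fun p hp => ((hq.differentiableOn one_ne_zero).differentiableAt (hnhds p hp)).hasFDerivAt)
    (fun p hp => ((hρ.differentiableOn one_ne_zero).differentiableAt (hnhds p hp)).hasFDerivAt)
    ((integrable_zero _ _ _).congr hae.symm)
  rw [integral_congr_ae hae] at key
  simp only [integral_zero, Function.uncurry] at key
  exact key.symm

lemma mass_balance {T : ℝ} (ρ u : ℝ → ℝ → ℝ)
    (hρ : ContDiffOn ℝ 1 (Function.uncurry ρ) (univ ×ˢ Ico (0:ℝ) T))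
    (hu : ContDiffOn ℝ 1 (Function.uncurry u) (univ ×ˢ Ico (0:ℝ) T))
    (hρpos : ∀ x, ∀ t ∈ Ico (0:ℝ) T, 0 < ρ x t)
    (hρint : ∀ t ∈ Ico (0:ℝ) T, Integrable fun x => ρ x t)
    (hρmass : ∀ t ∈ Ico (0:ℝ) T, ∫ x, ρ x t = 1)
    (hubdd : ∃ C, ∀ x, ∀ t ∈ Ico (0:ℝ) T, |u x t| ≤ C)
    (hcont : ∀ x, ∀ t ∈ Ico (0:ℝ) T,
      derivWithin (fun τ => ρ x τ) (Ico 0 T) t + deriv (fun y => ρ y t * u y t) x = 0)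
    (b s t : ℝ) (hst : s ≤ t) (hs : s ∈ Ico (0:ℝ) T) (ht : t ∈ Ico (0:ℝ) T) :
    (∫ x in Iic b, ρ x t) - (∫ x in Iic b, ρ x s) = - ∫ τ in s..t, ρ b τ * u b τ := by
  obtain ⟨C, hC⟩ := hubdd
  have hsub : (univ ×ˢ Ioc s t : Set (ℝ × ℝ)) ⊆ univ ×ˢ Ico (0:ℝ) T := by
    rintro ⟨x, τ⟩ ⟨h1, h2⟩
    exact ⟨mem_univ _, hs.1.trans h2.1.le, lt_of_le_of_lt h2.2 ht.2⟩
  have hq : ContDiffOn ℝ 1 (Function.uncurry fun x t => ρ x t * u x t) (univ ×ˢ Ico (0:ℝ) T) :=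
    hρ.mul hu
  have hbox := fun a (ha : a ≤ b) => box_balance ρ (fun x t => ρ x t * u x t) hρ hq hcont a b s t
    ha hst hs ht
  have hmeas : (volume : Measure ℝ).prod (volume.restrict (Ioc s t)) =
      (volume : Measure (ℝ × ℝ)).restrict (univ ×ˢ Ioc s t) := by
    rw [Measure.volume_eq_prod, ← Measure.prod_restrict, Measure.restrict_univ]
  have hms : MeasurableSet (univ ×ˢ Ioc s t : Set (ℝ × ℝ)) :=
    MeasurableSet.univ.prod measurableSet_Ioc
  have hρm : AEStronglyMeasurable (Function.uncurry ρ)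
      ((volume : Measure ℝ).prod (volume.restrict (Ioc s t))) := by
    rw [hmeas]; exact (hρ.continuousOn.mono hsub).aestronglyMeasurable hms
  have hum : AEStronglyMeasurable (Function.uncurry u)
      ((volume : Measure ℝ).prod (volume.restrict (Ioc s t))) := by
    rw [hmeas]; exact (hu.continuousOn.mono hsub).aestronglyMeasurable hms
  have hIoc : ∀ τ ∈ Ioc s t, τ ∈ Ico 0 T := fun τ h =>
    ⟨hs.1.trans h.1.le, lt_of_le_of_lt h.2 ht.2⟩
  have hρi : Integrable (Function.uncurry ρ)
      ((volume : Measure ℝ).prod (volume.restrict (Ioc s t))) := by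
    rw [integrable_prod_iff' hρm]
    constructor
    · filter_upwards [ae_restrict_mem measurableSet_Ioc] with τ hτ
      exact hρint τ (hIoc τ hτ)
    · refine (integrable_const (1:ℝ)).congr ?_
      filter_upwards [ae_restrict_mem measurableSet_Ioc] with τ hτ
      rw [← hρmass τ (hIoc τ hτ)]
      refine integral_congr_ae (Eventually.of_forall fun x => ?_)
      exact (abs_of_pos (hρpos x τ (hIoc τ hτ))).symm
  have hqi : Integrable (fun p : ℝ × ℝ => Function.uncurry ρ p * Function.uncurry u p)
      ((volume : Measure ℝ).prod (volume.restrict (Ioc s t))) := by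
    refine hρi.mul_bdd (c := C) hum ?_
    rw [hmeas]
    filter_upwards [ae_restrict_mem hms] with p hp
    exact hC p.1 p.2 (hsub hp).2
  have hH := hqi.integral_prod_left
  have hlim : Tendsto (fun a => ∫ τ in Ioc s t, ρ a τ * u a τ) atBot
      (𝓝 ((∫ x in Iic b, ρ x t) - (∫ x in Iic b, ρ x s) + ∫ τ in s..t, ρ b τ * u b τ)) := by
    have h1 := intervalIntegral_tendsto_integral_Iic b (hρint t ht).integrableOn tendsto_id
    have h2 := intervalIntegral_tendsto_integral_Iic b (hρint s hs).integrableOn tendsto_id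
    refine ((h1.sub h2).add_const _).congr' ?_
    filter_upwards [eventually_le_atBot b] with a ha
    have := hbox a ha
    rw [← intervalIntegral.integral_of_le hst]
    simp only [id]
    linarith
  have := IntegrableAtFilter.eq_zero_of_tendsto (hH.integrableAtFilter atBot) (fun S hS => by
    rcases mem_atBot_sets.1 hS with ⟨b, hb⟩
    apply le_antisymm (le_top)
    rw [← Real.volume_Iic (a := b)]
    exact measure_mono hb) hlim
  linarith

lemma mass_balance' {T : ℝ} (ρ u : ℝ → ℝ → ℝ)
    (hρ : ContDiffOn ℝ 1 (Function.uncurry ρ) (univ ×ˢ Ico (0:ℝ) T))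
    (hu : ContDiffOn ℝ 1 (Function.uncurry u) (univ ×ˢ Ico (0:ℝ) T))
    (hρpos : ∀ x, ∀ t ∈ Ico (0:ℝ) T, 0 < ρ x t)
    (hρint : ∀ t ∈ Ico (0:ℝ) T, Integrable fun x => ρ x t)
    (hρmass : ∀ t ∈ Ico (0:ℝ) T, ∫ x, ρ x t = 1)
    (hubdd : ∃ C, ∀ x, ∀ t ∈ Ico (0:ℝ) T, |u x t| ≤ C)
    (hcont : ∀ x, ∀ t ∈ Ico (0:ℝ) T,
      derivWithin (fun τ => ρ x τ) (Ico 0 T) t + deriv (fun y => ρ y t * u y t) x = 0)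
    (x t : ℝ) (ht : t ∈ Ico (0:ℝ) T) :
    HasDerivWithinAt (fun τ => ∫ z in Iic x, ρ z τ) (-(ρ x t * u x t)) (Ico 0 T) t := by
  obtain ⟨b, htb, hbT⟩ := exists_between ht.2
  have hmem : ∀ τ, max 0 (min τ b) ∈ Ico (0:ℝ) T := fun τ =>
    ⟨le_max_left _ _, max_lt (ht.1.trans_lt ht.2) ((min_le_right _ _).trans_lt hbT)⟩
  have hcl : ∀ τ, 0 ≤ τ → τ ≤ b → max 0 (min τ b) = τ := fun τ h1 h2 => by
    rw [min_eq_left h2, max_eq_right h1]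
  set g : ℝ → ℝ := fun τ => ρ x (max 0 (min τ b)) * u x (max 0 (min τ b)) with hg
  have hgc : Continuous g := by
    have h : ContinuousOn (fun τ => ρ x τ * u x τ) (Ico 0 T) :=
      (slice_t ρ hρ.continuousOn x).mul (slice_t u hu.continuousOn x)
    rw [← continuousOn_univ]
    exact h.comp (f := fun τ : ℝ => max 0 (min τ b)) (by fun_prop) (fun τ _ => hmem τ)
  have hderiv : HasDerivAt (fun τ => (∫ z in Iic x, ρ z t) - ∫ σ in t..τ, g σ)
      (-(ρ x t * u x t)) t := by
    have h := (hgc.integral_hasStrictDerivAt t t).hasDerivAt.const_sub (∫ z in Iic x, ρ z t)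
    have : g t = ρ x t * u x t := by simp only [hg, hcl t ht.1 htb.le]
    rwa [this] at h
  refine hderiv.hasDerivWithinAt.congr_of_eventuallyEq ?_ (by simp)
  filter_upwards [self_mem_nhdsWithin, mem_nhdsWithin_of_mem_nhds (Iio_mem_nhds htb)] with τ h1 h2
  have h2 : τ < b := h2
  have hcg : ∫ σ in t..τ, g σ = ∫ σ in t..τ, ρ x σ * u x σ := by
    refine intervalIntegral.integral_congr fun σ hσ => ?_
    have := hσ.1
    have := hσ.2
    simp only [hg]
    rw [hcl σ ((le_min ht.1 h1.1).trans hσ.1) (hσ.2.trans (max_le htb.le h2.le))]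
  rw [hcg]
  rcases le_total t τ with h | h
  · have := mass_balance ρ u hρ hu hρpos hρint hρmass hubdd hcont x t τ h ht h1
    linarith
  · have := mass_balance ρ u hρ hu hρpos hρint hρmass hubdd hcont x τ t h h1 ht
    rw [intervalIntegral.integral_symm]
    linarith

/-- abstract implicit function step -/
lemma flow_deriv {T : ℝ} (ρ M : ℝ → ℝ → ℝ) (X : ℝ → ℝ) (m w t : ℝ)
    (ht : t ∈ Ico (0:ℝ) T)
    (hρ : ContinuousOn (Function.uncurry ρ) (univ ×ˢ Ico (0:ℝ) T))
    (hρpos : ∀ x, ∀ t ∈ Ico (0:ℝ) T, 0 < ρ x t)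
    (hMx : ∀ x, ∀ t ∈ Ico (0:ℝ) T, HasDerivAt (fun y => M y t) (ρ x t) x)
    (hMt : ∀ x, ContinuousWithinAt (fun τ => M x τ) (Ico 0 T) t)
    (hMt' : HasDerivWithinAt (fun τ => M (X t) τ) (-(ρ (X t) t * w)) (Ico 0 T) t)
    (hX : ∀ τ ∈ Ico (0:ℝ) T, M (X τ) τ = m) :
    HasDerivWithinAt X w (Ico 0 T) t := by
  have hmono : ∀ τ ∈ Ico (0:ℝ) T, StrictMono (fun y => M y τ) := fun τ hτ =>
    strictMono_of_deriv_pos fun x => by rw [(hMx x τ hτ).deriv]; exact hρpos x τ hτ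
  have hXc : Tendsto X (𝓝[Ico 0 T] t) (𝓝 (X t)) := by
    rw [tendsto_order]
    constructor
    · intro a ha
      have h1 : M a t < m := by rw [← hX t ht]; exact hmono t ht ha
      filter_upwards [(hMt a).eventually_lt_const h1, self_mem_nhdsWithin] with τ h2 hτ
      rw [← hX τ hτ] at h2
      exact (hmono τ hτ).lt_iff_lt.1 h2
    · intro a ha
      have h1 : m < M a t := by rw [← hX t ht]; exact hmono t ht ha
      filter_upwards [(hMt a).eventually_const_lt h1, self_mem_nhdsWithin] with τ h2 hτ
      rw [← hX τ hτ] at h2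
      exact (hmono τ hτ).lt_iff_lt.1 h2
  have hmv : ∀ τ, ∃ ξ, ξ ∈ uIcc (X t) (X τ) ∧ (τ ∈ Ico (0:ℝ) T →
      M (X τ) τ - M (X t) τ = ρ ξ τ * (X τ - X t)) := by
    intro τ
    by_cases hτ : τ ∈ Ico (0:ℝ) T
    swap
    · exact ⟨X t, left_mem_uIcc, fun h => absurd h hτ⟩
    have hcts : Continuous (fun y => M y τ) :=
      continuous_iff_continuousAt.2 fun x => (hMx x τ hτ).continuousAt
    rcases lt_trichotomy (X t) (X τ) with h | h | h
    · obtain ⟨c, hc, hc'⟩ := exists_hasDerivAt_eq_slope (fun y => M y τ) (fun y => ρ y τ) h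
        hcts.continuousOn (fun y _ => hMx y τ hτ)
      refine ⟨c, Icc_subset_uIcc (Ioo_subset_Icc_self hc), fun _ => ?_⟩
      rw [hc', div_mul_cancel₀ _ (sub_ne_zero.2 h.ne')]
    · exact ⟨X t, left_mem_uIcc, fun _ => by rw [← h]; simp⟩
    · obtain ⟨c, hc, hc'⟩ := exists_hasDerivAt_eq_slope (fun y => M y τ) (fun y => ρ y τ) h
        hcts.continuousOn (fun y _ => hMx y τ hτ)
      refine ⟨c, Icc_subset_uIcc' (Ioo_subset_Icc_self hc), fun _ => ?_⟩
      have : X t - X τ ≠ 0 := sub_ne_zero.2 h.ne'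
      rw [hc']
      field_simp
      ring
  choose ξ hξ hξ' using hmv
  have hξc : Tendsto ξ (𝓝[Ico 0 T] t) (𝓝 (X t)) := by
    have h1 : Tendsto (fun τ => min (X t) (X τ)) (𝓝[Ico 0 T] t) (𝓝 (X t)) := by
      simpa using (tendsto_const_nhds (x := X t)).min hXc
    have h2 : Tendsto (fun τ => max (X t) (X τ)) (𝓝[Ico 0 T] t) (𝓝 (X t)) := by
      simpa using (tendsto_const_nhds (x := X t)).max hXc
    exact tendsto_of_tendsto_of_tendsto_of_le_of_le h1 h2 (fun τ => (hξ τ).1) (fun τ => (hξ τ).2)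
  have hρξ : Tendsto (fun τ => ρ (ξ τ) τ) (𝓝[Ico 0 T] t) (𝓝 (ρ (X t) t)) := by
    have h0 : Tendsto (Function.uncurry ρ) (𝓝[univ ×ˢ Ico (0:ℝ) T] (X t, t)) (𝓝 (ρ (X t) t)) :=
      hρ (X t, t) ⟨mem_univ _, ht⟩
    refine h0.comp (f := fun τ => (ξ τ, τ)) (tendsto_nhdsWithin_iff.2 ⟨?_, ?_⟩)
    · exact hξc.prodMk_nhds (tendsto_id.mono_left nhdsWithin_le_nhds)
    · filter_upwards [self_mem_nhdsWithin] with τ hτ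
      exact ⟨mem_univ _, hτ⟩
  rw [hasDerivWithinAt_iff_tendsto_slope] at hMt' ⊢
  have hle : 𝓝[Ico 0 T \ {t}] t ≤ 𝓝[Ico 0 T] t := nhdsWithin_mono _ sdiff_subset
  have hpos := hρpos (X t) t ht
  have h := hMt'.neg.div (hρξ.mono_left hle) hpos.ne'
  have e : - -(ρ (X t) t * w) / ρ (X t) t = w := by field_simp
  rw [e] at h
  refine h.congr' ?_
  filter_upwards [self_mem_nhdsWithin] with τ hτ
  have h3 := hξ' τ hτ.1
  have h4 := hρpos (ξ τ) τ hτ.1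
  have h5 : τ - t ≠ 0 := sub_ne_zero.2 hτ.2
  rw [hX τ hτ.1] at h3
  simp only [slope_def_field, Pi.div_apply]
  rw [hX t ht]
  field_simp
  linarith

/-- decoupling of the velocity equation in mass coordinates.
Let `φ : [0,1] → [0,∞)` be continuous and bounded, and let `(ρ,u)` be a C¹,
everywhere-positive, unit-mass, bounded-velocity solution of the purely topological
Euler Alignment system on `ℝ × [0,T)`, with `M(x,t) := ∫_{−∞}^x ρ(z,t) dz`.
Then, for `X(m,t)` the (unique) `x` with `M(x,t) = m`, the velocity in mass
coordinates `v(m,t) := u(X(m,t),t)` satisfies the decoupled autonomous equation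
`∂_t v(m,t) = −∫₀¹ φ(|m−m'|)(v(m,t)−v(m',t)) dm'` on `(0,1) × [0,T)`. -/
theorem velocity_equation_decouples
    (φ : ℝ → ℝ) (hφc : Continuous φ)
    (hφnn : ∀ r ∈ Icc (0:ℝ) 1, 0 ≤ φ r) (hφbdd : ∃ C, ∀ r ∈ Icc (0:ℝ) 1, φ r ≤ C)
    (T : ℝ) (hT : 0 < T)
    (ρ u : ℝ → ℝ → ℝ)
    (hρC1 : ContDiffOn ℝ 1 (Function.uncurry ρ) (univ ×ˢ Ico (0:ℝ) T))
    (huC1 : ContDiffOn ℝ 1 (Function.uncurry u) (univ ×ˢ Ico (0:ℝ) T))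
    (hρpos : ∀ x, ∀ t ∈ Ico (0:ℝ) T, 0 < ρ x t)
    (hρint : ∀ t ∈ Ico (0:ℝ) T, Integrable fun x => ρ x t)
    (hρmass : ∀ t ∈ Ico (0:ℝ) T, ∫ x, ρ x t = 1)
    (hubdd : ∃ C, ∀ x, ∀ t ∈ Ico (0:ℝ) T, |u x t| ≤ C)
    (M : ℝ → ℝ → ℝ) (hM : ∀ x t, M x t = ∫ z in Iic x, ρ z t)
    -- continuity equation `∂_t ρ + ∂_x(ρ u) = 0`
    (hcont : ∀ x, ∀ t ∈ Ico (0:ℝ) T,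
      derivWithin (fun τ => ρ x τ) (Ico 0 T) t + deriv (fun y => ρ y t * u y t) x = 0)
    -- momentum equation
    -- `∂_t u + u ∂_x u = −∫ φ(|M(x,t)−M(y,t)|)(u(x,t)−u(y,t)) ρ(y,t) dy`
    (hmom : ∀ x, ∀ t ∈ Ico (0:ℝ) T,
      derivWithin (fun τ => u x τ) (Ico 0 T) t + u x t * deriv (fun y => u y t) x =
        -∫ y, φ |M x t - M y t| * (u x t - u y t) * ρ y t)
    (X : ℝ → ℝ → ℝ)
    (hX : ∀ m ∈ Ioo (0:ℝ) 1, ∀ t ∈ Ico (0:ℝ) T, M (X m t) t = m) :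
    ∀ m ∈ Ioo (0:ℝ) 1, ∀ t ∈ Ico (0:ℝ) T,
      HasDerivWithinAt (fun τ => u (X m τ) τ)
        (-∫ m' in Ioo (0:ℝ) 1, φ |m - m'| * (u (X m t) t - u (X m' t) t))
        (Ico 0 T) t := by
  intro m hm t ht
  have hρc := fun t (ht : t ∈ Ico (0:ℝ) T) => slice_x ρ hρC1.continuousOn t ht
  have hMx : ∀ x, ∀ t ∈ Ico (0:ℝ) T, HasDerivAt (fun y => M y t) (ρ x t) x := by
    intro x t ht
    have h : (fun y => M y t) = fun y => M 0 t + ∫ z in (0:ℝ)..y, ρ z t := by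
      funext y
      rw [hM, hM, ← intervalIntegral.integral_Iic_sub_Iic (hρint t ht).integrableOn
        (hρint t ht).integrableOn]
      ring
    rw [h]
    exact ((hρc t ht).integral_hasStrictDerivAt 0 x).hasDerivAt.const_add _
  have hMt : ∀ x, ∀ t ∈ Ico (0:ℝ) T,
      HasDerivWithinAt (fun τ => M x τ) (-(ρ x t * u x t)) (Ico 0 T) t := by
    intro x t ht
    simp only [hM]
    exact mass_balance' ρ u hρC1 huC1 hρpos hρint hρmass hubdd hcont x t ht
  have hXd : HasDerivWithinAt (X m) (u (X m t) t) (Ico 0 T) t :=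
    flow_deriv ρ M (X m) m (u (X m t) t) t ht hρC1.continuousOn hρpos hMx
      (fun x => (hMt x t ht).continuousWithinAt) (hMt _ t ht) (hX m hm)
  have hmono : StrictMono (fun y => M y t) :=
    strictMono_of_deriv_pos fun x => by rw [(hMx x t ht).deriv]; exact hρpos x t ht
  have hpos : ∀ S : Set ℝ, 0 < volume S → 0 < ∫ x in S, ρ x t := by
    intro S hS
    rw [setIntegral_pos_iff_support_of_nonneg_ae
      (Eventually.of_forall fun x => (hρpos x t ht).le) (hρint t ht).integrableOn]
    have : Function.support (fun x => ρ x t) = univ := by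
      ext x; simpa using (hρpos x t ht).ne'
    rwa [this, univ_inter]
  have hM01 : ∀ y, M y t ∈ Ioo (0:ℝ) 1 := by
    intro y
    have h1 := hpos (Iic y) (by simp)
    have h2 := hpos (Ioi y) (by simp)
    have h3 := intervalIntegral.integral_Iic_add_Ioi (b := y) (hρint t ht).integrableOn
      (hρint t ht).integrableOn
    rw [hρmass t ht] at h3
    rw [hM]
    constructor <;> linarith
  have hXM : ∀ y, X (M y t) t = y := fun y => hmono.injective (hX _ (hM01 y) t ht)
  have himg : (fun y => M y t) '' univ = Ioo (0:ℝ) 1 := by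
    ext m'
    constructor
    · rintro ⟨y, -, rfl⟩
      exact hM01 y
    · intro h
      exact ⟨X m' t, mem_univ _, hX m' h t ht⟩
  have hint : ∫ m' in Ioo (0:ℝ) 1, φ |m - m'| * (u (X m t) t - u (X m' t) t) =
      ∫ y, φ |M (X m t) t - M y t| * (u (X m t) t - u y t) * ρ y t := by
    rw [← himg, integral_image_eq_integral_abs_deriv_smul MeasurableSet.univ
      (fun x _ => (hMx x t ht).hasDerivWithinAt) hmono.injective.injOn, setIntegral_univ]
    refine integral_congr_ae (Eventually.of_forall fun y => ?_)
    simp only [hXM, hX m hm t ht, abs_of_pos (hρpos y t ht), smul_eq_mul]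
    ring
  obtain ⟨L, hL, hL1, hL2⟩ := partials_aux u huC1 (X m t) t ht
  have h1 : HasDerivWithinAt (fun τ : ℝ => (X m τ, τ)) (u (X m t) t, (1:ℝ)) (Ico 0 T) t :=
    hXd.prodMk (hasDerivWithinAt_id t _)
  have h2 := HasFDerivWithinAt.comp_hasDerivWithinAt (f := fun τ : ℝ => (X m τ, τ))
    (t := univ ×ˢ Ico (0:ℝ) T) t hL h1
    (fun y hy => ⟨mem_univ _, hy⟩)
  have hval : L (u (X m t) t, 1) =
      -∫ m' in Ioo (0:ℝ) 1, φ |m - m'| * (u (X m t) t - u (X m' t) t) := by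
    rw [hint, ← hmom (X m t) t ht, ← hL1, ← hL2]
    have : ((u (X m t) t, 1) : ℝ × ℝ) = (0, 1) + u (X m t) t • (1, 0) := by ext <;> simp
    rw [this, map_add, map_smul, smul_eq_mul]
  rw [← hval]
  exact h2
end

section
/- Let φ : [0,1] → [0,∞) be bounded and measurable, let L be the associated alignment operator on L²(0,1), and let v : [0,∞) → L²(0,1) be a differentiable curve with v'(t) = −L v(t) for all t ≥ 0. Then the mean is conserved: ∫₀¹ v(t)(m) dm = ∫₀¹ v(0)(m) dm for all t ≥ 0. -/
open MeasureTheory Set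
open scoped ENNReal

/-- The alignment kernel is antisymmetric, so its double integral vanishes. -/
theorem alignment_integral_zero
    (φ : ℝ → ℝ) (hφmeas : Measurable φ)
    (hφnn : ∀ r ∈ Icc (0:ℝ) 1, 0 ≤ φ r)
    (hφbdd : ∃ C, ∀ r ∈ Icc (0:ℝ) 1, φ r ≤ C)
    (f : ℝ → ℝ) (hf : Integrable f (volume.restrict (Ioo (0:ℝ) 1))) :
    ∫ m in Ioo (0:ℝ) 1, ∫ m' in Ioo (0:ℝ) 1, φ |m - m'| * (f m - f m') = 0 := by
  obtain ⟨C, hC⟩ := hφbdd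
  have hint : Integrable (fun p : ℝ × ℝ => φ |p.1 - p.2| * (f p.1 - f p.2))
      ((volume.restrict (Ioo (0:ℝ) 1)).prod (volume.restrict (Ioo (0:ℝ) 1))) := by
    refine Integrable.bdd_mul (c := C) ((hf.comp_fst _).sub (hf.comp_snd _)) ?_ ?_
    · exact (hφmeas.comp (by fun_prop : Measurable fun p : ℝ × ℝ => |p.1 - p.2|)).aestronglyMeasurable
    · rw [Measure.prod_restrict]
      filter_upwards [ae_restrict_mem (measurableSet_Ioo.prod measurableSet_Ioo)] with p hp
      obtain ⟨⟨h1, h2⟩, h3, h4⟩ := hp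
      have hm : |p.1 - p.2| ∈ Icc (0:ℝ) 1 :=
        ⟨abs_nonneg _, abs_le.2 ⟨by linarith, by linarith⟩⟩
      rw [Real.norm_eq_abs, abs_of_nonneg (hφnn _ hm)]
      exact hC _ hm
  have hswap := integral_integral_swap (f := fun m m' => φ |m - m'| * (f m - f m')) hint
  have hanti : ∀ m m' : ℝ, φ |m - m'| * (f m - f m') = -(φ |m' - m| * (f m' - f m)) := by
    intro m m'
    rw [abs_sub_comm]; ring
  have hneg : ∫ m' in Ioo (0:ℝ) 1, ∫ m in Ioo (0:ℝ) 1, φ |m - m'| * (f m - f m')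
      = -∫ m in Ioo (0:ℝ) 1, ∫ m' in Ioo (0:ℝ) 1, φ |m - m'| * (f m - f m') := by
    rw [← integral_neg]
    congr 1; funext m'
    rw [← integral_neg]
    congr 1; funext m
    exact hanti m m'
  linarith

/-- conservation of the mean.
Let `φ : [0,1] → [0,∞)` be bounded measurable, `L` the associated alignment operator
on `L²(0,1)`, i.e. `(Lf)(m) = ∫₀¹ φ(|m−m'|)(f(m)−f(m')) dm'`, and let
`v : [0,∞) → L²(0,1)` be differentiable with `v'(t) = −Lv(t)`. Then
`∫₀¹ v(t) = ∫₀¹ v(0)` for all `t ≥ 0`. -/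
theorem alignment_mean_conserved
    (φ : ℝ → ℝ) (hφmeas : Measurable φ)
    (hφnn : ∀ r ∈ Icc (0:ℝ) 1, 0 ≤ φ r)
    (hφbdd : ∃ C, ∀ r ∈ Icc (0:ℝ) 1, φ r ≤ C)
    (L : Lp ℝ 2 (volume.restrict (Ioo (0:ℝ) 1)) →L[ℝ]
         Lp ℝ 2 (volume.restrict (Ioo (0:ℝ) 1)))
    (hL : ∀ f : Lp ℝ 2 (volume.restrict (Ioo (0:ℝ) 1)),
      ⇑(L f) =ᵐ[volume.restrict (Ioo (0:ℝ) 1)]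
        fun m => ∫ m' in Ioo (0:ℝ) 1, φ |m - m'| * (f m - f m'))
    (v : ℝ → Lp ℝ 2 (volume.restrict (Ioo (0:ℝ) 1)))
    (hv : ∀ t, 0 ≤ t → HasDerivWithinAt v (-(L (v t))) (Ici 0) t) :
    ∀ t, 0 ≤ t →
      ∫ m in Ioo (0:ℝ) 1, (v t) m = ∫ m in Ioo (0:ℝ) 1, (v 0) m := by
  intro t ht
  let e : Lp ℝ 2 (volume.restrict (Ioo (0:ℝ) 1)) := indicatorConstLp 2 MeasurableSet.univ (measure_ne_top _ univ) (1:ℝ)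
  have he : ∀ f : Lp ℝ 2 (volume.restrict (Ioo (0:ℝ) 1)), innerSL ℝ e f = ∫ m in Ioo (0:ℝ) 1, f m := by
    intro f
    rw [innerSL_apply_apply, L2.inner_indicatorConstLp_one, Measure.restrict_univ]
  have hL0 : ∀ f : Lp ℝ 2 (volume.restrict (Ioo (0:ℝ) 1)), innerSL ℝ e (L f) = 0 := by
    intro f
    rw [he, integral_congr_ae (hL f)]
    exact alignment_integral_zero φ hφmeas hφnn hφbdd f
      ((Lp.memLp f).integrable (by norm_num))
  have hd : ∀ s, 0 ≤ s → HasDerivWithinAt (fun s => innerSL ℝ e (v s)) 0 (Ici 0) s := by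
    intro s hs
    have h := (innerSL ℝ e).hasFDerivAt.comp_hasDerivWithinAt s (hv s hs)
    rw [map_neg, hL0, neg_zero] at h
    exact h
  have key := constant_of_has_deriv_right_zero (f := fun s => innerSL ℝ e (v s)) (a := 0) (b := t)
    (fun s hs => ((hd s hs.1).continuousWithinAt).mono Icc_subset_Ici_self)
    (fun s hs => (hd s hs.1).mono (Ici_subset_Ici.2 hs.1)) t ⟨ht, le_rfl⟩
  simp only [he] at key
  exact key
end
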